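/- For every t ≥ 1, P(MAP(Z_1, ..., Z_{t-1}, X_t) ≠ θ) = P_1(MAP(Z_1, ..., Z_{t-1}, X_t) = 2), and this quantity satisfies the bounds P_1(R_{t-1} < b/a) ≤ P(MAP(Z_1, ..., Z_{t-1}, X_t) ≠ θ) ≤ P_1(R_{t-1} ≤ a/b). -/

import Mathlib

open MeasureTheory ProbabilityTheory Filter Asymptotics
open scoped ENNReal NNReal

noncomputable section

/-- The constant `κ*(a,b)` from the paper. -/
def kappaStar (a b : ℝ) : ℝ :=
  1 / (1 + (a / b - 1) / Real.log (a / b) *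
      (Real.log ((a / b - 1) / Real.log (a / b)) - 1))

/-- The signal distribution: `signalProb a b i x = P(X_t = x | θ = i)`,
equal to `a/(a+b)` if `x = i` and `b/(a+b)` otherwise. -/
def signalProb (a b : ℝ) (i x : ℕ) : ℝ :=
  if x = i then a / (a + b) else b / (a + b)

/-- The D-likelihood `D_i^t = Q_i^t(Z_1,…,Z_{t-1},X_t)`: the conditional probability, given
`θ = i`, of observing the actions `Z_1,…,Z_{t-1}` and private signal `X_t` that actually
occurred at the sample point `ω`. -/
def Dlike {Ω : Type*} [MeasurableSpace Ω] (μ : Measure Ω) (θ : Ω → ℕ)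
    (X Z : ℕ → Ω → ℕ) (t : ℕ) (i : ℕ) (ω : Ω) : ℝ :=
  (μ {ω' | θ ω' = i ∧ (∀ s ∈ Finset.Icc 1 (t - 1), Z s ω' = Z s ω) ∧ X t ω' = X t ω}).toReal
    / (μ {ω' | θ ω' = i}).toReal

/-- The maximum a posteriori estimate of `θ` given `(Z_1,…,Z_{t-1},X_t)`, with ties broken
by following the private signal `X_t`.  (The prior on `θ` is uniform, so comparing the
posteriors amounts to comparing `D_1^t` and `D_2^t`.) -/
def mapEst {Ω : Type*} [MeasurableSpace Ω] (μ : Measure Ω) (θ : Ω → ℕ)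
    (X Z : ℕ → Ω → ℕ) (t : ℕ) (ω : Ω) : ℕ :=
  if Dlike μ θ X Z t 2 ω < Dlike μ θ X Z t 1 ω then 1
  else if Dlike μ θ X Z t 1 ω < Dlike μ θ X Z t 2 ω then 2
  else X t ω

/-- The L-likelihood `L_i^t = P_i(Z_1 = z_1, …, Z_t = z_t)` evaluated at the observed
actions. -/
def Llike {Ω : Type*} [MeasurableSpace Ω] (μ : Measure Ω) (θ : Ω → ℕ)
    (Z : ℕ → Ω → ℕ) (t : ℕ) (i : ℕ) (ω : Ω) : ℝ :=
  (μ {ω' | θ ω' = i ∧ ∀ s ∈ Finset.Icc 1 t, Z s ω' = Z s ω}).toReal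
    / (μ {ω' | θ ω' = i}).toReal

/-- The likelihood ratio `R_t = L_1^t / L_2^t` (with `R_0 = 1`). -/
def LR {Ω : Type*} [MeasurableSpace Ω] (μ : Measure Ω) (θ : Ω → ℕ)
    (Z : ℕ → Ω → ℕ) (t : ℕ) (ω : Ω) : ℝ :=
  Llike μ θ Z t 1 ω / Llike μ θ Z t 2 ω

/-- The sequential decision making model with Bayesians and revealers.
`θ` is the state of the world, uniform on `{1,2}`; given `θ`, the signals `X_t` are i.i.d.
with `P(X_t = θ | θ) = a/(a+b)`, the revealing indicators `I_t` are independent Bernoulli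
with `E[I_t] = p_t`, independent of everything else (this is the content of `joint`), and
the actions are `Z_t = X_t` if `I_t = 1` and `Z_t = MAP(Z_1,…,Z_{t-1},X_t)` if `I_t = 0`
(field `dynamics`).  Players are indexed by `t ≥ 1`; `Z 0` is set to the constant `1` for
definiteness. -/
structure IsCascade (a b : ℝ) (p : ℕ → ℝ) {Ω : Type*} [MeasurableSpace Ω]
    (μ : Measure Ω) (θ : Ω → ℕ) (X I Z : ℕ → Ω → ℕ) : Prop where
  prob : IsProbabilityMeasure μ
  theta_meas : Measurable θ
  X_meas : ∀ t, Measurable (X t)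
  I_meas : ∀ t, Measurable (I t)
  Z_meas : ∀ t, Measurable (Z t)
  p_mem : ∀ t : ℕ, 1 ≤ t → p t ∈ Set.Icc (0 : ℝ) 1
  theta_range : ∀ ω, θ ω = 1 ∨ θ ω = 2
  X_range : ∀ t ω, X t ω = 1 ∨ X t ω = 2
  I_range : ∀ t ω, I t ω = 0 ∨ I t ω = 1
  Z_zero : ∀ ω, Z 0 ω = 1
  joint : ∀ i : ℕ, i = 1 ∨ i = 2 → ∀ s : Finset ℕ, (∀ t ∈ s, 1 ≤ t) →
    ∀ x c : ℕ → ℕ, (∀ t, x t = 1 ∨ x t = 2) → (∀ t, c t = 0 ∨ c t = 1) →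
    (μ {ω | θ ω = i ∧ ∀ t ∈ s, X t ω = x t ∧ I t ω = c t}).toReal
      = 1 / 2 * ∏ t ∈ s, signalProb a b i (x t) * (if c t = 1 then p t else 1 - p t)
  dynamics : ∀ t : ℕ, 1 ≤ t → ∀ ω,
    Z t ω = if I t ω = 1 then X t ω else mapEst μ θ X Z t ω

/-- The error probability `E_t = P(Z_t ≠ θ)`. -/
def errProb {Ω : Type*} [MeasurableSpace Ω] (μ : Measure Ω) (θ : Ω → ℕ)
    (Z : ℕ → Ω → ℕ) (t : ℕ) : ℝ :=
  (μ {ω | Z t ω ≠ θ ω}).toReal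

/-- The probability that the MAP estimator is wrong at time `t`:
`P(MAP(Z_1,…,Z_{t-1},X_t) ≠ θ)`. -/
def mapErr {Ω : Type*} [MeasurableSpace Ω] (μ : Measure Ω) (θ : Ω → ℕ)
    (X Z : ℕ → Ω → ℕ) (t : ℕ) : ℝ :=
  (μ {ω | mapEst μ θ X Z t ω ≠ θ ω}).toReal

section Helpers

/-- `Dlike` as a function of the observed history. -/
def DD {Ω : Type*} [MeasurableSpace Ω] (μ : Measure Ω) (θ : Ω → ℕ)
    (X Z : ℕ → Ω → ℕ) (t : ℕ) (i : ℕ) (z : ℕ → ℕ) (x : ℕ) : ℝ :=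
  (μ {ω' | θ ω' = i ∧ (∀ s ∈ Finset.Icc 1 (t - 1), Z s ω' = z s) ∧ X t ω' = x}).toReal
    / (μ {ω' | θ ω' = i}).toReal

/-- `mapEst` as a function of the observed history. -/
def MM {Ω : Type*} [MeasurableSpace Ω] (μ : Measure Ω) (θ : Ω → ℕ)
    (X Z : ℕ → Ω → ℕ) (t : ℕ) (z : ℕ → ℕ) (x : ℕ) : ℕ :=
  if DD μ θ X Z t 2 z x < DD μ θ X Z t 1 z x then 1
  else if DD μ θ X Z t 1 z x < DD μ θ X Z t 2 z x then 2
  else x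

/-- Probability of the indicator value `c`. -/
def pc (p : ℕ → ℝ) (t c : ℕ) : ℝ := if c = 1 then p t else 1 - p t

/-- One term of the likelihood recursion. -/
def termW (a b : ℝ) (p : ℕ → ℝ) (M : ℕ → (ℕ → ℕ) → ℕ → ℕ) (i n : ℕ) (z : ℕ → ℕ)
    (x c : ℕ) : ℝ :=
  if (if c = 1 then x else M (n + 1) z x) = z (n + 1) then
    signalProb a b i x * pc p (n + 1) c else 0

/-- The joint likelihood of the history, by recursion. -/
def W (a b : ℝ) (p : ℕ → ℝ) (M : ℕ → (ℕ → ℕ) → ℕ → ℕ) (i : ℕ) : ℕ → (ℕ → ℕ) → ℝ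
  | 0, _ => 1 / 2
  | n + 1, z => W a b p M i n z *
      (termW a b p M i n z 1 0 + termW a b p M i n z 1 1
        + termW a b p M i n z 2 0 + termW a b p M i n z 2 1)

variable {Ω : Type*} [MeasurableSpace Ω]

lemma split_two (μ : Measure Ω) [IsProbabilityMeasure μ] (f : Ω → ℕ) (hf : Measurable f)
    (u v : ℕ) (huv : u ≠ v) (h : ∀ ω, f ω = u ∨ f ω = v) (A : Set Ω) :
    (μ A).toReal = (μ (A ∩ {ω | f ω = u})).toReal + (μ (A ∩ {ω | f ω = v})).toReal := by
  have hm : MeasurableSet {ω | f ω = u} := hf (measurableSet_singleton u)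
  have h1 := measure_inter_add_sdiff (μ := μ) A hm
  have h2 : A \ {ω | f ω = u} = A ∩ {ω | f ω = v} := by
    ext ω
    have := h ω
    simp only [Set.mem_sdiff, Set.mem_ofPred_eq, Set.mem_inter_iff]
    grind
  rw [h2] at h1
  rw [← h1, ENNReal.toReal_add (measure_ne_top _ _) (measure_ne_top _ _)]

lemma MM_congr (μ : Measure Ω) (θ : Ω → ℕ) (X Z : ℕ → Ω → ℕ) (n : ℕ) (z z' : ℕ → ℕ) (x : ℕ)
    (h : ∀ s ∈ Finset.Icc 1 n, z s = z' s) :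
    MM μ θ X Z (n + 1) z x = MM μ θ X Z (n + 1) z' x := by
  have hD : ∀ i, DD μ θ X Z (n + 1) i z x = DD μ θ X Z (n + 1) i z' x := by
    intro i
    have : {ω' | θ ω' = i ∧ (∀ s ∈ Finset.Icc 1 (n + 1 - 1), Z s ω' = z s) ∧ X (n + 1) ω' = x}
      = {ω' | θ ω' = i ∧ (∀ s ∈ Finset.Icc 1 (n + 1 - 1), Z s ω' = z' s) ∧ X (n + 1) ω' = x} := by
      ext ω
      simp only [Set.mem_ofPred_eq, Nat.add_sub_cancel]
      constructor
      · rintro ⟨h1, h2, h3⟩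
        exact ⟨h1, fun s hs => (h2 s hs).trans (h s hs), h3⟩
      · rintro ⟨h1, h2, h3⟩
        exact ⟨h1, fun s hs => (h2 s hs).trans (h s hs).symm, h3⟩
    simp only [DD, this]
  simp only [MM, hD]

variable {a b : ℝ} {p : ℕ → ℝ} {μ : Measure Ω} {θ : Ω → ℕ} {X I Z : ℕ → Ω → ℕ}

lemma joint_W (hC : IsCascade a b p μ θ X I Z) (i : ℕ) (hi : i = 1 ∨ i = 2) (n : ℕ) :
    ∀ (z : ℕ → ℕ) (S : Finset ℕ), (∀ s ∈ S, n < s) →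
    ∀ x c : ℕ → ℕ, (∀ t, x t = 1 ∨ x t = 2) → (∀ t, c t = 0 ∨ c t = 1) →
    (μ {ω | θ ω = i ∧ (∀ s ∈ Finset.Icc 1 n, Z s ω = z s) ∧
        ∀ s ∈ S, X s ω = x s ∧ I s ω = c s}).toReal
      = W a b p (MM μ θ X Z) i n z * ∏ s ∈ S, signalProb a b i (x s) * pc p s (c s) := by
  have := hC.prob
  induction n with
  | zero =>
    intro z S hS x c hx hc
    have := hC.joint i hi S (fun t ht => hS t ht) x c hx hc
    simpa [W, pc] using this
  | succ n ih =>
    intro z S hS x c hx hc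
    have key : ∀ x0 c0 : ℕ, (x0 = 1 ∨ x0 = 2) → (c0 = 0 ∨ c0 = 1) →
        (μ ({ω | θ ω = i ∧ (∀ s ∈ Finset.Icc 1 (n + 1), Z s ω = z s) ∧
          ∀ s ∈ S, X s ω = x s ∧ I s ω = c s} ∩ {ω | X (n + 1) ω = x0} ∩
            {ω | I (n + 1) ω = c0})).toReal
        = W a b p (MM μ θ X Z) i n z * termW a b p (MM μ θ X Z) i n z x0 c0 *
          ∏ s ∈ S, signalProb a b i (x s) * pc p s (c s) := by
      intro x0 c0 hx0 hc0
      have hnS : n + 1 ∉ S := fun h => lt_irrefl _ (hS _ h)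
      have hZ : ∀ ω, (∀ s ∈ Finset.Icc 1 n, Z s ω = z s) → X (n + 1) ω = x0 →
          I (n + 1) ω = c0 →
          Z (n + 1) ω = if c0 = 1 then x0 else MM μ θ X Z (n + 1) z x0 := by
        intro ω h1 h2 h3
        rw [hC.dynamics (n + 1) (by omega) ω, h2, h3]
        congr 1
        rw [← MM_congr μ θ X Z n (fun s => Z s ω) z x0 h1, ← h2]
        rfl
      unfold termW
      by_cases hv : (if c0 = 1 then x0 else MM μ θ X Z (n + 1) z x0) = z (n + 1)
      · rw [if_pos hv]
        have hset : ({ω | θ ω = i ∧ (∀ s ∈ Finset.Icc 1 (n + 1), Z s ω = z s) ∧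
            ∀ s ∈ S, X s ω = x s ∧ I s ω = c s} ∩ {ω | X (n + 1) ω = x0} ∩
            {ω | I (n + 1) ω = c0})
          = {ω | θ ω = i ∧ (∀ s ∈ Finset.Icc 1 n, Z s ω = z s) ∧
            ∀ s ∈ insert (n + 1) S, X s ω = Function.update x (n + 1) x0 s ∧
              I s ω = Function.update c (n + 1) c0 s} := by
          ext ω
          simp only [Set.mem_inter_iff, Set.mem_ofPred_eq]
          constructor
          · rintro ⟨⟨⟨h1, h2, h3⟩, h4⟩, h5⟩
            refine ⟨h1, fun s hs => h2 s (by simp at hs ⊢; omega), ?_⟩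
            intro s hs
            rcases Finset.mem_insert.1 hs with rfl | hs
            · simp [h4, h5]
            · have hne : s ≠ n + 1 := fun h => hnS (h ▸ hs)
              simpa [Function.update_of_ne hne] using h3 s hs
          · rintro ⟨h1, h2, h3⟩
            have h4 := h3 (n + 1) (Finset.mem_insert_self _ _)
            simp only [Function.update_self] at h4
            refine ⟨⟨⟨h1, ?_, ?_⟩, h4.1⟩, h4.2⟩
            · intro s hs
              by_cases hsn : s = n + 1
              · rw [hsn, hZ ω h2 h4.1 h4.2, hv]
              · exact h2 s (by simp at hs ⊢; omega)
            · intro s hs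
              have hne : s ≠ n + 1 := fun h => hnS (h ▸ hs)
              simpa [Function.update_of_ne hne] using h3 s (Finset.mem_insert_of_mem hs)
        rw [hset, ih z (insert (n + 1) S) ?_ _ _ ?_ ?_, Finset.prod_insert hnS]
        · simp only [Function.update_self]
          rw [mul_assoc (W a b p (MM μ θ X Z) i n z)]
          congr 2
          apply Finset.prod_congr rfl
          intro s hs
          have hne : s ≠ n + 1 := fun h => hnS (h ▸ hs)
          simp [Function.update_of_ne hne]
        · intro s hs
          rcases Finset.mem_insert.1 hs with rfl | hs
          · omega
          · have := hS s hs
            omega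
        · intro t
          by_cases h : t = n + 1
          · subst h; simpa using hx0
          · simpa [Function.update_of_ne h] using hx t
        · intro t
          by_cases h : t = n + 1
          · subst h; simpa using hc0
          · simpa [Function.update_of_ne h] using hc t
      · rw [if_neg hv]
        have hset : ({ω | θ ω = i ∧ (∀ s ∈ Finset.Icc 1 (n + 1), Z s ω = z s) ∧
            ∀ s ∈ S, X s ω = x s ∧ I s ω = c s} ∩ {ω | X (n + 1) ω = x0} ∩
            {ω | I (n + 1) ω = c0}) = ∅ := by
          ext ω
          simp only [Set.mem_inter_iff, Set.mem_ofPred_eq, Set.mem_empty_iff_false, iff_false]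
          rintro ⟨⟨⟨h1, h2, h3⟩, h4⟩, h5⟩
          apply hv
          rw [← hZ ω (fun s hs => h2 s (by simp at hs ⊢; omega)) h4 h5]
          exact h2 (n + 1) (by simp)
        rw [hset]
        simp
    rw [split_two μ (X (n + 1)) (hC.X_meas _) 1 2 (by norm_num) (hC.X_range _),
      split_two μ (I (n + 1)) (hC.I_meas _) 0 1 (by norm_num) (hC.I_range _),
      split_two μ (I (n + 1)) (hC.I_meas _) 0 1 (by norm_num) (hC.I_range _) (_ ∩ {ω | X _ ω = 2}),
      key 1 0 (by simp) (by simp), key 1 1 (by simp) (by simp),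
      key 2 0 (by simp) (by simp), key 2 1 (by simp) (by simp), W]
    ring

lemma hist_W (hC : IsCascade a b p μ θ X I Z) (i : ℕ) (hi : i = 1 ∨ i = 2) (n : ℕ)
    (z : ℕ → ℕ) :
    (μ {ω | θ ω = i ∧ (∀ s ∈ Finset.Icc 1 n, Z s ω = z s)}).toReal
      = W a b p (MM μ θ X Z) i n z := by
  have := joint_W hC i hi n z ∅ (by simp) (fun _ => 1) (fun _ => 0) (by simp) (by simp)
  simpa using this

lemma theta_half (hC : IsCascade a b p μ θ X I Z) (i : ℕ) (hi : i = 1 ∨ i = 2) :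
    (μ {ω | θ ω = i}).toReal = 1 / 2 := by
  have := hist_W hC i hi 0 (fun _ => 1)
  simpa [W] using this

lemma histX_W (hC : IsCascade a b p μ θ X I Z) (i : ℕ) (hi : i = 1 ∨ i = 2) (n : ℕ)
    (z : ℕ → ℕ) (x : ℕ) (hx : x = 1 ∨ x = 2) :
    (μ {ω | θ ω = i ∧ (∀ s ∈ Finset.Icc 1 n, Z s ω = z s) ∧ X (n + 1) ω = x}).toReal
      = W a b p (MM μ θ X Z) i n z * signalProb a b i x := by
  have := hC.prob
  have h : ∀ c, (c = 0 ∨ c = 1) →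
      (μ ({ω | θ ω = i ∧ (∀ s ∈ Finset.Icc 1 n, Z s ω = z s) ∧ X (n + 1) ω = x} ∩
        {ω | I (n + 1) ω = c})).toReal
      = W a b p (MM μ θ X Z) i n z * (signalProb a b i x * pc p (n + 1) c) := by
    intro c hc
    have := joint_W hC i hi n z {n + 1} (by simp) (fun _ => x) (fun _ => c)
      (by simpa using hx) (by simpa using hc)
    rw [Finset.prod_singleton] at this
    rw [← this]
    congr 2
    ext ω
    simp [and_assoc]
  rw [split_two μ (I (n + 1)) (hC.I_meas _) 0 1 (by norm_num) (hC.I_range _),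
    h 0 (by simp), h 1 (by simp)]
  simp only [pc]
  norm_num
  ring

lemma DD_W (hC : IsCascade a b p μ θ X I Z) (i : ℕ) (hi : i = 1 ∨ i = 2) (n : ℕ)
    (z : ℕ → ℕ) (x : ℕ) (hx : x = 1 ∨ x = 2) :
    DD μ θ X Z (n + 1) i z x = W a b p (MM μ θ X Z) i n z * signalProb a b i x / (1 / 2) := by
  unfold DD
  rw [theta_half hC i hi, Nat.add_sub_cancel, histX_W hC i hi n z x hx]

lemma sig_swap (x : ℕ) (hx : x = 1 ∨ x = 2) :
    signalProb a b 2 (3 - x) = signalProb a b 1 x ∧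
    signalProb a b 1 (3 - x) = signalProb a b 2 x := by
  rcases hx with rfl | rfl <;> simp [signalProb]

lemma MM_range (μ : Measure Ω) (θ : Ω → ℕ) (X Z : ℕ → Ω → ℕ) (t : ℕ) (z : ℕ → ℕ) (x : ℕ)
    (hx : x = 1 ∨ x = 2) : MM μ θ X Z t z x = 1 ∨ MM μ θ X Z t z x = 2 := by
  unfold MM
  split_ifs <;> simp [hx]

lemma MM_swap (hC : IsCascade a b p μ θ X I Z) (n : ℕ) (z : ℕ → ℕ)
    (hW1 : W a b p (MM μ θ X Z) 1 n (fun s => 3 - z s) = W a b p (MM μ θ X Z) 2 n z)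
    (hW2 : W a b p (MM μ θ X Z) 2 n (fun s => 3 - z s) = W a b p (MM μ θ X Z) 1 n z)
    (x : ℕ) (hx : x = 1 ∨ x = 2) :
    MM μ θ X Z (n + 1) (fun s => 3 - z s) (3 - x) = 3 - MM μ θ X Z (n + 1) z x := by
  have hx' : 3 - x = 1 ∨ 3 - x = 2 := by omega
  have h1 : DD μ θ X Z (n + 1) 1 (fun s => 3 - z s) (3 - x) = DD μ θ X Z (n + 1) 2 z x := by
    rw [DD_W hC 1 (by simp) n _ _ hx', DD_W hC 2 (by simp) n _ _ hx, hW1, (sig_swap x hx).2]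
  have h2 : DD μ θ X Z (n + 1) 2 (fun s => 3 - z s) (3 - x) = DD μ θ X Z (n + 1) 1 z x := by
    rw [DD_W hC 1 (by simp) n _ _ hx, DD_W hC 2 (by simp) n _ _ hx', hW2, (sig_swap x hx).1]
  unfold MM
  rw [h1, h2]
  split_ifs with h3 h4
  · exact absurd h3 (lt_asymm h4)
  all_goals rfl

lemma W_swap (hC : IsCascade a b p μ θ X I Z) (n : ℕ) (z : ℕ → ℕ)
    (hz : ∀ s, z s = 1 ∨ z s = 2) :
    W a b p (MM μ θ X Z) 1 n (fun s => 3 - z s) = W a b p (MM μ θ X Z) 2 n z ∧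
    W a b p (MM μ θ X Z) 2 n (fun s => 3 - z s) = W a b p (MM μ θ X Z) 1 n z := by
  induction n with
  | zero => simp [W]
  | succ n ih =>
    have hM := MM_swap hC n z ih.1 ih.2
    have ht : ∀ x c, (x = 1 ∨ x = 2) →
        termW a b p (MM μ θ X Z) 1 n (fun s => 3 - z s) (3 - x) c
          = termW a b p (MM μ θ X Z) 2 n z x c ∧
        termW a b p (MM μ θ X Z) 2 n (fun s => 3 - z s) (3 - x) c
          = termW a b p (MM μ θ X Z) 1 n z x c := by
      intro x c hx
      unfold termW
      rw [hM x hx, (sig_swap x hx).1, (sig_swap x hx).2]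
      have hiff : ((if c = 1 then 3 - x else 3 - MM μ θ X Z (n + 1) z x) = 3 - z (n + 1)) ↔
          ((if c = 1 then x else MM μ θ X Z (n + 1) z x) = z (n + 1)) := by
        have h1 := MM_range μ θ X Z (n + 1) z x hx
        have h2 := hz (n + 1)
        split_ifs <;> omega
      simp only [hiff, and_self]
    have e1 := fun c => ht 1 c (by simp)
    have e2 := fun c => ht 2 c (by simp)
    norm_num at e1 e2
    simp only [W, ih.1, ih.2, (e1 _).1, (e1 _).2, (e2 _).1, (e2 _).2]
    constructor <;> ring

lemma sig_bounds (hb : 0 < b) (hab : b < a) (x : ℕ) :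
    0 < signalProb a b 1 x ∧ 0 < signalProb a b 2 x ∧
    signalProb a b 1 x ≤ a / b * signalProb a b 2 x ∧
    signalProb a b 2 x ≤ a / b * signalProb a b 1 x := by
  have ha : 0 < a := hb.trans hab
  have h1 : 0 < a / (a + b) := by positivity
  have h2 : 0 < b / (a + b) := by positivity
  have e1 : a / b * (b / (a + b)) = a / (a + b) := by field_simp
  have e2 : b / (a + b) ≤ a / (a + b) := by gcongr
  have e3 : 1 ≤ a / b := by rw [le_div_iff₀ hb]; linarith
  have e4 : a / (a + b) ≤ a / b * (a / (a + b)) := le_mul_of_one_le_left h1.le e3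
  unfold signalProb
  split_ifs with g1 g2 <;> refine ⟨by assumption, by assumption, ?_, ?_⟩ <;>
    linarith

lemma W_nonneg (hC : IsCascade a b p μ θ X I Z) (i : ℕ) (hi : i = 1 ∨ i = 2) (n : ℕ)
    (z : ℕ → ℕ) : 0 ≤ W a b p (MM μ θ X Z) i n z := by
  rw [← hist_W hC i hi n z]
  exact ENNReal.toReal_nonneg

lemma W_le (hC : IsCascade a b p μ θ X I Z) (hb : 0 < b) (hab : b < a) (n : ℕ)
    (z : ℕ → ℕ) :
    W a b p (MM μ θ X Z) 1 n z ≤ (a / b) ^ n * W a b p (MM μ θ X Z) 2 n z := by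
  have ha : 0 < a := hb.trans hab
  induction n with
  | zero => simp [W]
  | succ n ih =>
    have hp := hC.p_mem (n + 1) (by omega)
    have hpc : ∀ c, 0 ≤ pc p (n + 1) c := by
      intro c
      unfold pc
      split_ifs
      · exact hp.1
      · linarith [hp.2]
    have ht : ∀ x c, 0 ≤ termW a b p (MM μ θ X Z) 1 n z x c ∧
        termW a b p (MM μ θ X Z) 1 n z x c
        ≤ a / b * termW a b p (MM μ θ X Z) 2 n z x c := by
      intro x c
      unfold termW
      have hs := sig_bounds hb hab x
      by_cases hv : (if c = 1 then x else MM μ θ X Z (n + 1) z x) = z (n + 1)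
      · rw [if_pos hv, if_pos hv]
        refine ⟨mul_nonneg hs.1.le (hpc c), ?_⟩
        rw [← mul_assoc]
        exact mul_le_mul_of_nonneg_right hs.2.2.1 (hpc c)
      · rw [if_neg hv, if_neg hv]
        simp
    have h2 := W_nonneg hC 2 (by simp) n z
    simp only [W]
    have hsum : (termW a b p (MM μ θ X Z) 1 n z 1 0 + termW a b p (MM μ θ X Z) 1 n z 1 1
        + termW a b p (MM μ θ X Z) 1 n z 2 0 + termW a b p (MM μ θ X Z) 1 n z 2 1)
      ≤ a / b * (termW a b p (MM μ θ X Z) 2 n z 1 0 + termW a b p (MM μ θ X Z) 2 n z 1 1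
        + termW a b p (MM μ θ X Z) 2 n z 2 0 + termW a b p (MM μ θ X Z) 2 n z 2 1) := by
      linarith [(ht 1 0).2, (ht 1 1).2, (ht 2 0).2, (ht 2 1).2]
    have hsum0 := add_nonneg (add_nonneg (add_nonneg (ht 1 0).1 (ht 1 1).1) (ht 2 0).1) (ht 2 1).1
    calc _ ≤ ((a / b) ^ n * W a b p (MM μ θ X Z) 2 n z) * (a / b * _) :=
          mul_le_mul ih hsum hsum0 (by positivity)
      _ = _ := by ring

lemma Z_range (hC : IsCascade a b p μ θ X I Z) (t : ℕ) (ω : Ω) : Z t ω = 1 ∨ Z t ω = 2 := by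
  rcases Nat.eq_zero_or_pos t with rfl | ht
  · exact Or.inl (hC.Z_zero ω)
  · rw [hC.dynamics t ht ω]
    split_ifs
    · exact hC.X_range t ω
    · exact MM_range μ θ X Z t (fun s => Z s ω) (X t ω) (hC.X_range t ω)

/-- Encoded observation. -/
def HH (X Z : ℕ → Ω → ℕ) (n : ℕ) (ω : Ω) : Fin (n + 1) → Bool :=
  fun k => if (k : ℕ) < n then decide (Z (k + 1) ω = 1) else decide (X (n + 1) ω = 1)

/-- Decoding of a bit. -/
def bit12 (v : Bool) : ℕ := if v then 1 else 2

/-- Decoded history. -/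
def zz (n : ℕ) (h : Fin (n + 1) → Bool) (s : ℕ) : ℕ :=
  bit12 (h ⟨min (s - 1) n, by omega⟩)

/-- Decoded signal. -/
def xx (n : ℕ) (h : Fin (n + 1) → Bool) : ℕ := bit12 (h ⟨n, by omega⟩)

lemma bit12_range (v : Bool) : bit12 v = 1 ∨ bit12 v = 2 := by
  cases v <;> simp [bit12]

lemma HH_iff (hC : IsCascade a b p μ θ X I Z) (n : ℕ) (h : Fin (n + 1) → Bool) (ω : Ω) :
    HH X Z n ω = h ↔
      (∀ s ∈ Finset.Icc 1 n, Z s ω = zz n h s) ∧ X (n + 1) ω = xx n h := by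
  have hbit : ∀ (m : ℕ) (v : Bool), (m = 1 ∨ m = 2) → (decide (m = 1) = v ↔ m = bit12 v) := by
    intro m v hm
    rcases hm with rfl | rfl <;> cases v <;> simp [bit12]
  constructor
  · rintro rfl
    constructor
    · intro s hs
      rw [Finset.mem_Icc] at hs
      unfold zz
      rw [← hbit _ _ (Z_range hC s ω)]
      have e1 : min (s - 1) n = s - 1 := by omega
      have e2 : s - 1 < n := by omega
      have e3 : s - 1 + 1 = s := by omega
      simp [HH, e1, e2, e3]
    · unfold xx
      rw [← hbit _ _ (hC.X_range _ ω)]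
      simp [HH]
  · rintro ⟨h1, h2⟩
    funext k
    unfold HH
    split_ifs with hk
    · rw [hbit _ _ (Z_range hC _ ω), h1 (k + 1) (by simp; omega)]
      unfold zz
      congr 2
      ext
      simp
      omega
    · rw [hbit _ _ (hC.X_range _ ω), h2]
      unfold xx
      congr 2
      ext
      simp
      omega

lemma HH_meas (hC : IsCascade a b p μ θ X I Z) (n : ℕ) (h : Fin (n + 1) → Bool) :
    MeasurableSet (HH X Z n ⁻¹' {h}) := by
  have : HH X Z n ⁻¹' {h} = (⋂ s ∈ Finset.Icc 1 n, Z s ⁻¹' {zz n h s}) ∩ X (n + 1) ⁻¹' {xx n h} := by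
    ext ω
    simp only [Set.mem_preimage, Set.mem_singleton_iff, HH_iff hC, Set.mem_inter_iff,
      Set.mem_iInter]
  rw [this]
  exact (Finset.measurableSet_biInter _ fun s _ => hC.Z_meas s (measurableSet_singleton _)).inter
    (hC.X_meas _ (measurableSet_singleton _))

lemma sum_HH (hC : IsCascade a b p μ θ X I Z) (n : ℕ) (A : Set Ω) :
    (μ A).toReal = ∑ h, (μ (HH X Z n ⁻¹' {h} ∩ A)).toReal := by
  have := hC.prob
  have := sum_measureReal_preimage_singleton (μ := μ.restrict A) Finset.univ
    (f := HH X Z n) (fun h _ => HH_meas hC n h)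
  simp only [Finset.coe_univ, Set.preimage_univ, measureReal_def, Measure.restrict_apply_univ]
    at this
  rw [← this]
  exact Finset.sum_congr rfl fun h _ => by rw [Measure.restrict_apply (HH_meas hC n h)]

lemma fiber_measure (hC : IsCascade a b p μ θ X I Z) (n i : ℕ) (hi : i = 1 ∨ i = 2)
    (h : Fin (n + 1) → Bool) :
    (μ (HH X Z n ⁻¹' {h} ∩ {ω | θ ω = i})).toReal
      = W a b p (MM μ θ X Z) i n (zz n h) * signalProb a b i (xx n h) := by
  rw [← histX_W hC i hi n (zz n h) (xx n h) (bit12_range _)]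
  congr 2
  ext ω
  simp only [Set.mem_inter_iff, Set.mem_preimage, Set.mem_singleton_iff, HH_iff hC,
    Set.mem_ofPred_eq]
  tauto

lemma map_prob (hC : IsCascade a b p μ θ X I Z) (n i k : ℕ) (hi : i = 1 ∨ i = 2) :
    (μ ({ω | θ ω = i} ∩ {ω | mapEst μ θ X Z (n + 1) ω = k})).toReal
      = ∑ h, if MM μ θ X Z (n + 1) (zz n h) (xx n h) = k then
          W a b p (MM μ θ X Z) i n (zz n h) * signalProb a b i (xx n h) else 0 := by
  rw [sum_HH hC n]
  refine Finset.sum_congr rfl fun h _ => ?_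
  have hm : ∀ ω, HH X Z n ω = h →
      mapEst μ θ X Z (n + 1) ω = MM μ θ X Z (n + 1) (zz n h) (xx n h) := by
    intro ω hω
    rw [HH_iff hC] at hω
    rw [← MM_congr μ θ X Z n _ _ _ hω.1, ← hω.2]
    rfl
  split_ifs with hk
  · rw [← fiber_measure hC n i hi h]
    congr 2
    ext ω
    simp only [Set.mem_inter_iff, Set.mem_preimage, Set.mem_singleton_iff, Set.mem_ofPred_eq]
    constructor
    · rintro ⟨h1, h2, _⟩
      exact ⟨h1, h2⟩
    · rintro ⟨h1, h2⟩
      exact ⟨h1, h2, (hm ω h1).trans hk⟩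
  · have : HH X Z n ⁻¹' {h} ∩ ({ω | θ ω = i} ∩ {ω | mapEst μ θ X Z (n + 1) ω = k}) = ∅ := by
      ext ω
      simp only [Set.mem_inter_iff, Set.mem_preimage, Set.mem_singleton_iff, Set.mem_ofPred_eq,
        Set.mem_empty_iff_false, iff_false]
      rintro ⟨h1, _, h3⟩
      exact hk ((hm ω h1).symm.trans h3)
    rw [this]
    simp

/-- Flipping all bits. -/
def flipE (n : ℕ) : (Fin (n + 1) → Bool) ≃ (Fin (n + 1) → Bool) where
  toFun h := fun k => !h k
  invFun h := fun k => !h k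
  left_inv h := by funext k; simp
  right_inv h := by funext k; simp

lemma map_symm (hC : IsCascade a b p μ θ X I Z) (n : ℕ) :
    (μ ({ω | θ ω = 2} ∩ {ω | mapEst μ θ X Z (n + 1) ω = 1})).toReal
      = (μ ({ω | θ ω = 1} ∩ {ω | mapEst μ θ X Z (n + 1) ω = 2})).toReal := by
  rw [map_prob hC n 2 1 (by simp), map_prob hC n 1 2 (by simp), ← Equiv.sum_comp (flipE n)]
  refine Finset.sum_congr rfl fun h _ => ?_
  have hb : ∀ v : Bool, bit12 (!v) = 3 - bit12 v := by intro v; cases v <;> rfl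
  have hzf : zz n (flipE n h) = fun s => 3 - zz n h s := by
    funext s
    exact hb _
  have hxf : xx n (flipE n h) = 3 - xx n h := hb _
  have hz : ∀ s, zz n h s = 1 ∨ zz n h s = 2 := fun s => bit12_range _
  have hx : xx n h = 1 ∨ xx n h = 2 := bit12_range _
  have hW := W_swap hC n (zz n h) hz
  rw [hzf, hxf, hW.2, (sig_swap _ hx).1, MM_swap hC n _ hW.1 hW.2 _ hx]
  have hr := MM_range μ θ X Z (n + 1) (zz n h) (xx n h) hx
  have : 3 - MM μ θ X Z (n + 1) (zz n h) (xx n h) = 1 ↔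
      MM μ θ X Z (n + 1) (zz n h) (xx n h) = 2 := by omega
  simp only [this]

lemma null_hist (hC : IsCascade a b p μ θ X I Z) (n : ℕ) :
    μ ({ω | θ ω = 1} ∩ {ω | W a b p (MM μ θ X Z) 1 n (fun s => Z s ω) = 0}) = 0 := by
  have := hC.prob
  have : (μ ({ω | θ ω = 1} ∩ {ω | W a b p (MM μ θ X Z) 1 n (fun s => Z s ω) = 0})).toReal
      = 0 := by
    rw [sum_HH hC n]
    refine Finset.sum_eq_zero fun h _ => ?_
    by_cases h0 : W a b p (MM μ θ X Z) 1 n (zz n h) = 0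
    · have h1 := fiber_measure hC n 1 (by simp) h
      rw [h0, zero_mul] at h1
      refine le_antisymm ?_ ENNReal.toReal_nonneg
      rw [← h1]
      refine ENNReal.toReal_mono (measure_ne_top _ _) (measure_mono ?_)
      rintro ω ⟨g1, g2, _⟩
      exact ⟨g1, g2⟩
    · have : HH X Z n ⁻¹' {h} ∩ ({ω | θ ω = 1} ∩
          {ω | W a b p (MM μ θ X Z) 1 n (fun s => Z s ω) = 0}) = ∅ := by
        ext ω
        simp only [Set.mem_inter_iff, Set.mem_preimage, Set.mem_singleton_iff, Set.mem_ofPred_eq,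
          Set.mem_empty_iff_false, iff_false]
        rintro ⟨g1, _, g3⟩
        apply h0
        rw [HH_iff hC] at g1
        rw [← g3, ← hist_W hC 1 (by simp), ← hist_W hC 1 (by simp)]
        congr 2
        ext ω'
        simp only [Set.mem_ofPred_eq]
        refine and_congr_right fun _ => forall₂_congr fun s hs => ?_
        rw [g1.1 s hs]
      rw [this]
      simp
  exact (ENNReal.toReal_eq_zero_iff _).1 this |>.resolve_right (measure_ne_top _ _)

lemma LR_W (hC : IsCascade a b p μ θ X I Z) (n : ℕ) (ω : Ω) :
    LR μ θ Z n ω = W a b p (MM μ θ X Z) 1 n (fun s => Z s ω)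
      / W a b p (MM μ θ X Z) 2 n (fun s => Z s ω) := by
  unfold LR Llike
  rw [theta_half hC 1 (by simp), theta_half hC 2 (by simp), ← hist_W hC 1 (by simp),
    ← hist_W hC 2 (by simp)]
  rw [div_div_div_cancel_right₀ (by norm_num)]

lemma map_dlike (hC : IsCascade a b p μ θ X I Z) (n : ℕ) (ω : Ω) (i : ℕ) (hi : i = 1 ∨ i = 2) :
    Dlike μ θ X Z (n + 1) i ω
      = W a b p (MM μ θ X Z) i n (fun s => Z s ω) * signalProb a b i (X (n + 1) ω) / (1 / 2) :=
  DD_W hC i hi n (fun s => Z s ω) (X (n + 1) ω) (hC.X_range _ ω)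

end Helpers

/-- For every `t ≥ 1`,
`P(MAP(Z_1,…,Z_{t-1},X_t) ≠ θ) = P_1(MAP(Z_1,…,Z_{t-1},X_t) = 2)`, and
`P_1(R_{t-1} < b/a) ≤ P(MAP(Z_1,…,Z_{t-1},X_t) ≠ θ) ≤ P_1(R_{t-1} ≤ a/b)`,
where `P_1` denotes probability conditioned on `θ = 1`. -/
theorem map_error_bounds (a b : ℝ) (hb : 0 < b) (hab : b < a)
    (p : ℕ → ℝ) {Ω : Type*} [MeasurableSpace Ω] (μ : Measure Ω) (θ : Ω → ℕ)
    (X I Z : ℕ → Ω → ℕ) (hC : IsCascade a b p μ θ X I Z) (t : ℕ) (ht : 1 ≤ t) :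
    mapErr μ θ X Z t
      = (μ[|{ω | θ ω = 1}] {ω | mapEst μ θ X Z t ω = 2}).toReal ∧
    (μ[|{ω | θ ω = 1}] {ω | LR μ θ Z (t - 1) ω < b / a}).toReal
      ≤ mapErr μ θ X Z t ∧
    mapErr μ θ X Z t
      ≤ (μ[|{ω | θ ω = 1}] {ω | LR μ θ Z (t - 1) ω ≤ a / b}).toReal := by
  have := hC.prob
  obtain ⟨n, rfl⟩ : ∃ n, t = n + 1 := ⟨t - 1, by omega⟩
  rw [Nat.add_sub_cancel]
  have ha : 0 < a := hb.trans hab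
  have hm : MeasurableSet {ω | θ ω = 1} := hC.theta_meas (measurableSet_singleton 1)
  have hcond : ∀ T : Set Ω, (μ[|{ω | θ ω = 1}] T).toReal = 2 * (μ ({ω | θ ω = 1} ∩ T)).toReal := by
    intro T
    rw [cond_apply hm, ENNReal.toReal_mul, ENNReal.toReal_inv, theta_half hC 1 (by simp)]
    norm_num
  have hr : ∀ ω, mapEst μ θ X Z (n + 1) ω = 1 ∨ mapEst μ θ X Z (n + 1) ω = 2 := fun ω =>
    MM_range μ θ X Z (n + 1) (fun s => Z s ω) _ (hC.X_range _ ω)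
  have herr : mapErr μ θ X Z (n + 1)
      = 2 * (μ ({ω | θ ω = 1} ∩ {ω | mapEst μ θ X Z (n + 1) ω = 2})).toReal := by
    unfold mapErr
    rw [split_two μ θ hC.theta_meas 1 2 (by norm_num) hC.theta_range]
    have e1 : {ω | mapEst μ θ X Z (n + 1) ω ≠ θ ω} ∩ {ω | θ ω = 1}
        = {ω | θ ω = 1} ∩ {ω | mapEst μ θ X Z (n + 1) ω = 2} := by
      ext ω
      have := hr ω
      simp only [Set.mem_inter_iff, Set.mem_ofPred_eq]
      omega
    have e2 : {ω | mapEst μ θ X Z (n + 1) ω ≠ θ ω} ∩ {ω | θ ω = 2}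
        = {ω | θ ω = 2} ∩ {ω | mapEst μ θ X Z (n + 1) ω = 1} := by
      ext ω
      have := hr ω
      simp only [Set.mem_inter_iff, Set.mem_ofPred_eq]
      omega
    rw [e1, e2, map_symm hC n]
    ring
  have hq : (b / a) * (a / b) = 1 := by field_simp
  refine ⟨by rw [herr, hcond], ?_, ?_⟩
  · rw [herr, hcond]
    refine mul_le_mul_of_nonneg_left ?_ (by norm_num)
    refine ENNReal.toReal_mono (measure_ne_top _ _) ?_
    calc μ ({ω | θ ω = 1} ∩ {ω | LR μ θ Z n ω < b / a})
        ≤ μ (({ω | θ ω = 1} ∩ {ω | mapEst μ θ X Z (n + 1) ω = 2}) ∪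
          ({ω | θ ω = 1} ∩ {ω | W a b p (MM μ θ X Z) 1 n (fun s => Z s ω) = 0})) := by
          refine measure_mono ?_
          rintro ω ⟨h1, h2⟩
          by_cases h0 : W a b p (MM μ θ X Z) 1 n (fun s => Z s ω) = 0
          · exact Or.inr ⟨h1, h0⟩
          refine Or.inl ⟨h1, ?_⟩
          have hw1 := lt_of_le_of_ne (W_nonneg hC 1 (by simp) n (fun s => Z s ω)) (Ne.symm h0)
          have hw2 : 0 < W a b p (MM μ θ X Z) 2 n (fun s => Z s ω) := by
            have := W_le hC hb hab n (fun s => Z s ω)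
            exact pos_of_mul_pos_right (lt_of_lt_of_le hw1 this) (by positivity)
          simp only [Set.mem_ofPred_eq, LR_W hC] at h2
          rw [div_lt_iff₀ hw2] at h2
          have hs := sig_bounds hb hab (X (n + 1) ω)
          have hlt : Dlike μ θ X Z (n + 1) 1 ω < Dlike μ θ X Z (n + 1) 2 ω := by
            rw [map_dlike hC n ω 1 (by simp), map_dlike hC n ω 2 (by simp)]
            refine div_lt_div_of_pos_right ?_ (by norm_num)
            calc _ < _ := mul_lt_mul_of_pos_right h2 hs.1
              _ ≤ (b / a * W a b p (MM μ θ X Z) 2 n (fun s => Z s ω)) *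
                  (a / b * signalProb a b 2 (X (n + 1) ω)) :=
                mul_le_mul_of_nonneg_left hs.2.2.1 (by positivity)
              _ = ((b / a) * (a / b)) * (W a b p (MM μ θ X Z) 2 n (fun s => Z s ω) *
                  signalProb a b 2 (X (n + 1) ω)) := by ring
              _ = _ := by rw [hq, one_mul]
          simp only [Set.mem_ofPred_eq]
          unfold mapEst
          rw [if_neg (lt_asymm hlt), if_pos hlt]
      _ ≤ _ := measure_union_le _ _
      _ = _ := by rw [null_hist hC n, add_zero]
  · rw [herr, hcond]
    refine mul_le_mul_of_nonneg_left ?_ (by norm_num)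
    refine ENNReal.toReal_mono (measure_ne_top _ _) (measure_mono ?_)
    rintro ω ⟨h1, h2⟩
    refine ⟨h1, ?_⟩
    simp only [Set.mem_ofPred_eq] at h2 ⊢
    have hle : Dlike μ θ X Z (n + 1) 1 ω ≤ Dlike μ θ X Z (n + 1) 2 ω := by
      by_contra hlt
      push Not at hlt
      unfold mapEst at h2
      rw [if_pos hlt] at h2
      norm_num at h2
    rw [map_dlike hC n ω 1 (by simp), map_dlike hC n ω 2 (by simp)] at hle
    have hle' := (div_le_div_iff_of_pos_right (by norm_num : (0 : ℝ) < 1 / 2)).1 hle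
    have hs := sig_bounds hb hab (X (n + 1) ω)
    have hn1 := W_nonneg hC 1 (by simp) n (fun s => Z s ω)
    have hn2 := W_nonneg hC 2 (by simp) n (fun s => Z s ω)
    rw [LR_W hC]
    refine div_le_of_le_mul₀ hn2 (by positivity) ?_
    refine le_of_mul_le_mul_right ?_ hs.1
    calc _ ≤ _ := hle'
      _ ≤ W a b p (MM μ θ X Z) 2 n (fun s => Z s ω) *
          (a / b * signalProb a b 1 (X (n + 1) ω)) := mul_le_mul_of_nonneg_left hs.2.2.2 hn2
      _ = _ := by ring
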